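/- Let {N_{ij}^k : 0 ≤ i,j,k ≤ 4} be nonnegative reals with an involution on indices given by 1̄ = 2, 3̄ = 4, 0̄ = 0, satisfying the unit conditions, the associativity equations Σ_s N_{ij}^s N_{sk}^ℓ = Σ_s N_{is}^ℓ N_{jk}^s, Frobenius reciprocity N_{ij}^k d_k = N_{j k̄}^{ī} d_{ī} with all d_i > 0 and d_i = d_{ī}. Then N_{12}^3 = N_{21}^3, and consequently the full fusion product is commutative: N_{ij}^k = N_{ji}^k for all i, j, k. -/

import Mathlib

set_option maxHeartbeats 4000000

def dualIdx : Fin 5 → Fin 5 := ![0, 2, 1, 4, 3]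


theorem fusion_sign (x y s t : ℝ) (h1 : 0 ≤ s - y / 2) (h2 : 0 ≤ s + y / 2)
    (h3 : 0 ≤ t - x / 2) (h4 : 0 ≤ t + x / 2) (h : x * s = y * t) : 0 ≤ x * y := by
  by_contra hc
  push Not at hc
  rcases lt_or_ge x 0 with hx | hx
  · have hy : 0 < y := by by_contra h0; push Not at h0; nlinarith
    nlinarith [mul_pos_of_neg_of_neg hx (by linarith : -s < 0), mul_nonneg hy.le (by linarith : 0 ≤ t)]
  · have hy : y < 0 := by by_contra h0; push Not at h0; nlinarith
    have hx' : 0 < x := by rcases hx.eq_or_lt with h0 | h0 <;> [(rw [← h0] at hc; linarith); exact h0]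
    nlinarith [mul_pos hx' (by linarith : 0 < s), mul_nonneg (by linarith : 0 ≤ -y) (by linarith : 0 ≤ t)]

theorem fusion_alg (v1 v2 v3 v4 s111 s112 s113 s114 s122 s123 s124 s133 s134 s144 s223 s233 s234
    s333 s334 s344 : ℝ) (hv : v2 ≠ 0) (hP : 0 ≤ v1 * v2) (hQ : 0 ≤ v3 * v4)
    (i113 : v2*s113=v4*s111)
    (i114 : v2*s114=v3*s111)
    (i133 : v2*s133=v4*s113)
    (i144 : v2*s144=v3*s114)
    (i112 : v2*s112=2*v2*s134-2*v4*s114+v1*s111)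
    (i123 : v2*s123=v3*s133-v4*s134+v4*s112)
    (i124 : v2*s124=v4*s144-v3*s134+v3*s112)
    (i334 : v2*s334=2*v4*s134-v3*s133)
    (i344 : v2*s344=2*v3*s134-v4*s144)
    (i333 : v2*s333=v4*s133)
    (i234 : v2*s234=v1*s134)
    (i122 : v2*(s234-s122)=v1*(s134-s112))
    (i233 : 2*v2*s233=2*v4*s123+v3*s333-v4*s334)
    (i223 : v2*s223=2*(v3*s233-v4*s234)+v4*s122)
    (E1 : s123*s124+s223*s114+s233*s144+s234*s134=1+(v1*v2+v3*v4)/4+s112*s234+s122*s134+s123*s344+s124*s334)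
    (E2 : s111*s234+s112*s134+s113*s344+s114*s334-(s113*s124+s123*s114+s133*s144+s134*s134)=v2^2/4)
    : False := by
  obtain ⟨k, rfl⟩ : ∃ k, s111 = k * v2 ^ 3 := ⟨s111 / v2 ^ 3, by field_simp⟩
  obtain ⟨r, rfl⟩ : ∃ r, s134 = r * v2 + k * v2 * v3 * v4 :=
    ⟨s134 / v2 - k * v3 * v4, by field_simp; ring⟩
  obtain rfl : s113 = k*v2^2*v4 := mul_left_cancel₀ hv (by linear_combination i113)
  obtain rfl : s114 = k*v2^2*v3 := mul_left_cancel₀ hv (by linear_combination i114)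
  obtain rfl : s133 = k*v2*v4^2 := mul_left_cancel₀ hv (by linear_combination i133)
  obtain rfl : s144 = k*v2*v3^2 := mul_left_cancel₀ hv (by linear_combination i144)
  obtain rfl : s112 = 2*r*v2+k*v2^2*v1 := mul_left_cancel₀ hv (by linear_combination i112)
  obtain rfl : s123 = r*v4+k*v1*v2*v4 := mul_left_cancel₀ hv (by linear_combination i123)
  obtain rfl : s124 = r*v3+k*v1*v2*v3 := mul_left_cancel₀ hv (by linear_combination i124)
  obtain rfl : s334 = 2*r*v4+k*v4^2*v3 := mul_left_cancel₀ hv (by linear_combination i334)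
  obtain rfl : s344 = 2*r*v3+k*v3^2*v4 := mul_left_cancel₀ hv (by linear_combination i344)
  obtain rfl : s333 = k*v4^3 := mul_left_cancel₀ hv (by linear_combination i333)
  obtain rfl : s234 = r*v1+k*v1*v3*v4 := mul_left_cancel₀ hv (by linear_combination i234)
  obtain rfl : s122 = 2*r*v1+k*v1^2*v2 := mul_left_cancel₀ hv (by linear_combination -i122)
  obtain rfl : s233 = k*v4^2*v1 := mul_left_cancel₀ hv (by linear_combination (1/2)*i233)
  obtain rfl : s223 = k*v1^2*v4 := mul_left_cancel₀ hv (by linear_combination i223)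
  have E3 : r ^ 2 + 2 * r * k * (v1 * v2 + v3 * v4) = 1 / 4 :=
    mul_left_cancel₀ (pow_ne_zero 2 hv) (by linear_combination E2)
  have E4 : 1 + (v1 * v2 + v3 * v4) / 2 + 2 * r ^ 2 * (v1 * v2 + v3 * v4) = 0 := by
    linear_combination -E1 - (v1 * v2 + v3 * v4) * E3
  have : 0 ≤ r ^ 2 * (v1 * v2 + v3 * v4) := by positivity
  linarith

/-- The normalized case (all `d i = 1`): one commutation relation. -/
theorem fusion_core (N : Fin 5 → Fin 5 → Fin 5 → ℝ)
    (hN : ∀ i j k, 0 ≤ N i j k)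
    (unitL : ∀ j s, N 0 j s = if j = s then 1 else 0)
    (unitR : ∀ j s, N j 0 s = if j = s then 1 else 0)
    (assoc : ∀ i j k l, ∑ s, N i j s * N s k l = ∑ s, N i s l * N j k s)
    (cyc : ∀ i j k, N i j k = N j (dualIdx k) (dualIdx i)) :
    N 1 3 3 = N 3 1 3 := by
  obtain ⟨v4, hv4⟩ : ∃ x, x = N 1 3 1 - N 1 2 4 := ⟨_, rfl⟩
  obtain ⟨s123, hs123⟩ : ∃ x, x = (N 1 2 4 + N 1 3 1) / 2 := ⟨_, rfl⟩
  obtain ⟨v3, hv3⟩ : ∃ x, x = N 1 2 3 - N 1 4 1 := ⟨_, rfl⟩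
  obtain ⟨s124, hs124⟩ : ∃ x, x = (N 1 2 3 + N 1 4 1) / 2 := ⟨_, rfl⟩
  obtain ⟨v2, hv2⟩ : ∃ x, x = N 1 4 4 - N 1 3 3 := ⟨_, rfl⟩
  obtain ⟨s134, hs134⟩ : ∃ x, x = (N 1 3 3 + N 1 4 4) / 2 := ⟨_, rfl⟩
  obtain ⟨v1, hv1⟩ : ∃ x, x = N 2 3 3 - N 2 4 4 := ⟨_, rfl⟩
  obtain ⟨s234, hs234⟩ : ∃ x, x = (N 2 3 3 + N 2 4 4) / 2 := ⟨_, rfl⟩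
  obtain ⟨s111, hs111⟩ : ∃ x, x = N 1 1 2 := ⟨_, rfl⟩
  obtain ⟨s112, hs112⟩ : ∃ x, x = N 1 1 1 := ⟨_, rfl⟩
  obtain ⟨s113, hs113⟩ : ∃ x, x = N 1 1 4 := ⟨_, rfl⟩
  obtain ⟨s114, hs114⟩ : ∃ x, x = N 1 1 3 := ⟨_, rfl⟩
  obtain ⟨s122, hs122⟩ : ∃ x, x = N 1 2 1 := ⟨_, rfl⟩
  obtain ⟨s133, hs133⟩ : ∃ x, x = N 1 3 4 := ⟨_, rfl⟩
  obtain ⟨s144, hs144⟩ : ∃ x, x = N 1 4 3 := ⟨_, rfl⟩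
  obtain ⟨s222, hs222⟩ : ∃ x, x = N 2 2 1 := ⟨_, rfl⟩
  obtain ⟨s223, hs223⟩ : ∃ x, x = N 2 2 4 := ⟨_, rfl⟩
  obtain ⟨s224, hs224⟩ : ∃ x, x = N 2 2 3 := ⟨_, rfl⟩
  obtain ⟨s233, hs233⟩ : ∃ x, x = N 2 3 4 := ⟨_, rfl⟩
  obtain ⟨s244, hs244⟩ : ∃ x, x = N 2 4 3 := ⟨_, rfl⟩
  obtain ⟨s333, hs333⟩ : ∃ x, x = N 3 3 4 := ⟨_, rfl⟩
  obtain ⟨s334, hs334⟩ : ∃ x, x = N 3 3 3 := ⟨_, rfl⟩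
  obtain ⟨s344, hs344⟩ : ∃ x, x = N 3 4 3 := ⟨_, rfl⟩
  obtain ⟨s444, hs444⟩ : ∃ x, x = N 4 4 3 := ⟨_, rfl⟩
  have e111 : N 1 1 2 = s111 := by linarith only [hs111]
  have e112 : N 1 1 1 = s112 := by linarith only [hs112]
  have e113 : N 1 1 4 = s113 := by linarith only [hs113]
  have e114 : N 1 1 3 = s114 := by linarith only [hs114]
  have e121 : N 1 2 2 = s112 := by rw [show N 1 2 2 = N 2 1 2 from cyc 1 2 2, show N 2 1 2 = N 1 1 1 from cyc 2 1 2]; linarith only [hs112]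
  have e122 : N 1 2 1 = s122 := by linarith only [hs122]
  have e123 : N 1 2 4 = s123 - v4 / 2 := by linarith only [hv4, hs123]
  have e124 : N 1 2 3 = s124 + v3 / 2 := by linarith only [hv3, hs124]
  have e131 : N 1 3 2 = s113 := by rw [show N 1 3 2 = N 3 1 2 from cyc 1 3 2, show N 3 1 2 = N 1 1 4 from cyc 3 1 2]; linarith only [hs113]
  have e132 : N 1 3 1 = s123 + v4 / 2 := by linarith only [hv4, hs123]
  have e133 : N 1 3 4 = s133 := by linarith only [hs133]
  have e134 : N 1 3 3 = s134 - v2 / 2 := by linarith only [hv2, hs134]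
  have e141 : N 1 4 2 = s114 := by rw [show N 1 4 2 = N 4 1 2 from cyc 1 4 2, show N 4 1 2 = N 1 1 3 from cyc 4 1 2]; linarith only [hs114]
  have e142 : N 1 4 1 = s124 - v3 / 2 := by linarith only [hv3, hs124]
  have e143 : N 1 4 4 = s134 + v2 / 2 := by linarith only [hv2, hs134]
  have e144 : N 1 4 3 = s144 := by linarith only [hs144]
  have e211 : N 2 1 2 = s112 := by rw [show N 2 1 2 = N 1 1 1 from cyc 2 1 2]; linarith only [hs112]
  have e212 : N 2 1 1 = s122 := by rw [show N 2 1 1 = N 1 2 1 from cyc 2 1 1]; linarith only [hs122]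
  have e213 : N 2 1 4 = s123 + v4 / 2 := by rw [show N 2 1 4 = N 1 3 1 from cyc 2 1 4]; linarith only [hv4, hs123]
  have e214 : N 2 1 3 = s124 - v3 / 2 := by rw [show N 2 1 3 = N 1 4 1 from cyc 2 1 3]; linarith only [hv3, hs124]
  have e221 : N 2 2 2 = s122 := by rw [show N 2 2 2 = N 2 1 1 from cyc 2 2 2, show N 2 1 1 = N 1 2 1 from cyc 2 1 1]; linarith only [hs122]
  have e222 : N 2 2 1 = s222 := by linarith only [hs222]
  have e223 : N 2 2 4 = s223 := by linarith only [hs223]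
  have e224 : N 2 2 3 = s224 := by linarith only [hs224]
  have e231 : N 2 3 2 = s123 - v4 / 2 := by rw [show N 2 3 2 = N 3 1 1 from cyc 2 3 2, show N 3 1 1 = N 1 2 4 from cyc 3 1 1]; linarith only [hv4, hs123]
  have e232 : N 2 3 1 = s223 := by rw [show N 2 3 1 = N 3 2 1 from cyc 2 3 1, show N 3 2 1 = N 2 2 4 from cyc 3 2 1]; linarith only [hs223]
  have e233 : N 2 3 4 = s233 := by linarith only [hs233]
  have e234 : N 2 3 3 = s234 + v1 / 2 := by linarith only [hv1, hs234]
  have e241 : N 2 4 2 = s124 + v3 / 2 := by rw [show N 2 4 2 = N 4 1 1 from cyc 2 4 2, show N 4 1 1 = N 1 2 3 from cyc 4 1 1]; linarith only [hv3, hs124]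
  have e242 : N 2 4 1 = s224 := by rw [show N 2 4 1 = N 4 2 1 from cyc 2 4 1, show N 4 2 1 = N 2 2 3 from cyc 4 2 1]; linarith only [hs224]
  have e243 : N 2 4 4 = s234 - v1 / 2 := by linarith only [hv1, hs234]
  have e244 : N 2 4 3 = s244 := by linarith only [hs244]
  have e311 : N 3 1 2 = s113 := by rw [show N 3 1 2 = N 1 1 4 from cyc 3 1 2]; linarith only [hs113]
  have e312 : N 3 1 1 = s123 - v4 / 2 := by rw [show N 3 1 1 = N 1 2 4 from cyc 3 1 1]; linarith only [hv4, hs123]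
  have e313 : N 3 1 4 = s133 := by rw [show N 3 1 4 = N 1 3 4 from cyc 3 1 4]; linarith only [hs133]
  have e314 : N 3 1 3 = s134 + v2 / 2 := by rw [show N 3 1 3 = N 1 4 4 from cyc 3 1 3]; linarith only [hv2, hs134]
  have e321 : N 3 2 2 = s123 + v4 / 2 := by rw [show N 3 2 2 = N 2 1 4 from cyc 3 2 2, show N 2 1 4 = N 1 3 1 from cyc 2 1 4]; linarith only [hv4, hs123]
  have e322 : N 3 2 1 = s223 := by rw [show N 3 2 1 = N 2 2 4 from cyc 3 2 1]; linarith only [hs223]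
  have e323 : N 3 2 4 = s233 := by rw [show N 3 2 4 = N 2 3 4 from cyc 3 2 4]; linarith only [hs233]
  have e324 : N 3 2 3 = s234 - v1 / 2 := by rw [show N 3 2 3 = N 2 4 4 from cyc 3 2 3]; linarith only [hv1, hs234]
  have e331 : N 3 3 2 = s133 := by rw [show N 3 3 2 = N 3 1 4 from cyc 3 3 2, show N 3 1 4 = N 1 3 4 from cyc 3 1 4]; linarith only [hs133]
  have e332 : N 3 3 1 = s233 := by rw [show N 3 3 1 = N 3 2 4 from cyc 3 3 1, show N 3 2 4 = N 2 3 4 from cyc 3 2 4]; linarith only [hs233]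
  have e333 : N 3 3 4 = s333 := by linarith only [hs333]
  have e334 : N 3 3 3 = s334 := by linarith only [hs334]
  have e341 : N 3 4 2 = s134 - v2 / 2 := by rw [show N 3 4 2 = N 4 1 4 from cyc 3 4 2, show N 4 1 4 = N 1 3 3 from cyc 4 1 4]; linarith only [hv2, hs134]
  have e342 : N 3 4 1 = s234 + v1 / 2 := by rw [show N 3 4 1 = N 4 2 4 from cyc 3 4 1, show N 4 2 4 = N 2 3 3 from cyc 4 2 4]; linarith only [hv1, hs234]
  have e343 : N 3 4 4 = s334 := by rw [show N 3 4 4 = N 4 3 4 from cyc 3 4 4, show N 4 3 4 = N 3 3 3 from cyc 4 3 4]; linarith only [hs334]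
  have e344 : N 3 4 3 = s344 := by linarith only [hs344]
  have e411 : N 4 1 2 = s114 := by rw [show N 4 1 2 = N 1 1 3 from cyc 4 1 2]; linarith only [hs114]
  have e412 : N 4 1 1 = s124 + v3 / 2 := by rw [show N 4 1 1 = N 1 2 3 from cyc 4 1 1]; linarith only [hv3, hs124]
  have e413 : N 4 1 4 = s134 - v2 / 2 := by rw [show N 4 1 4 = N 1 3 3 from cyc 4 1 4]; linarith only [hv2, hs134]
  have e414 : N 4 1 3 = s144 := by rw [show N 4 1 3 = N 1 4 3 from cyc 4 1 3]; linarith only [hs144]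
  have e421 : N 4 2 2 = s124 - v3 / 2 := by rw [show N 4 2 2 = N 2 1 3 from cyc 4 2 2, show N 2 1 3 = N 1 4 1 from cyc 2 1 3]; linarith only [hv3, hs124]
  have e422 : N 4 2 1 = s224 := by rw [show N 4 2 1 = N 2 2 3 from cyc 4 2 1]; linarith only [hs224]
  have e423 : N 4 2 4 = s234 + v1 / 2 := by rw [show N 4 2 4 = N 2 3 3 from cyc 4 2 4]; linarith only [hv1, hs234]
  have e424 : N 4 2 3 = s244 := by rw [show N 4 2 3 = N 2 4 3 from cyc 4 2 3]; linarith only [hs244]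
  have e431 : N 4 3 2 = s134 + v2 / 2 := by rw [show N 4 3 2 = N 3 1 3 from cyc 4 3 2, show N 3 1 3 = N 1 4 4 from cyc 3 1 3]; linarith only [hv2, hs134]
  have e432 : N 4 3 1 = s234 - v1 / 2 := by rw [show N 4 3 1 = N 3 2 3 from cyc 4 3 1, show N 3 2 3 = N 2 4 4 from cyc 3 2 3]; linarith only [hv1, hs234]
  have e433 : N 4 3 4 = s334 := by rw [show N 4 3 4 = N 3 3 3 from cyc 4 3 4]; linarith only [hs334]
  have e434 : N 4 3 3 = s344 := by rw [show N 4 3 3 = N 3 4 3 from cyc 4 3 3]; linarith only [hs344]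
  have e441 : N 4 4 2 = s144 := by rw [show N 4 4 2 = N 4 1 3 from cyc 4 4 2, show N 4 1 3 = N 1 4 3 from cyc 4 1 3]; linarith only [hs144]
  have e442 : N 4 4 1 = s244 := by rw [show N 4 4 1 = N 4 2 3 from cyc 4 4 1, show N 4 2 3 = N 2 4 3 from cyc 4 2 3]; linarith only [hs244]
  have e443 : N 4 4 4 = s344 := by rw [show N 4 4 4 = N 4 3 3 from cyc 4 4 4, show N 4 3 3 = N 3 4 3 from cyc 4 3 3]; linarith only [hs344]
  have e444 : N 4 4 3 = s444 := by linarith only [hs444]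
  have g11 : N 1 1 0 = 0 := by rw [show N 1 1 0 = N 1 0 2 from cyc 1 1 0, unitR]; rfl
  have g12 : N 1 2 0 = 1 := by rw [show N 1 2 0 = N 2 0 2 from cyc 1 2 0, unitR]; rfl
  have g13 : N 1 3 0 = 0 := by rw [show N 1 3 0 = N 3 0 2 from cyc 1 3 0, unitR]; rfl
  have g14 : N 1 4 0 = 0 := by rw [show N 1 4 0 = N 4 0 2 from cyc 1 4 0, unitR]; rfl
  have g21 : N 2 1 0 = 1 := by rw [show N 2 1 0 = N 1 0 1 from cyc 2 1 0, unitR]; rfl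
  have g22 : N 2 2 0 = 0 := by rw [show N 2 2 0 = N 2 0 1 from cyc 2 2 0, unitR]; rfl
  have g23 : N 2 3 0 = 0 := by rw [show N 2 3 0 = N 3 0 1 from cyc 2 3 0, unitR]; rfl
  have g24 : N 2 4 0 = 0 := by rw [show N 2 4 0 = N 4 0 1 from cyc 2 4 0, unitR]; rfl
  have g31 : N 3 1 0 = 0 := by rw [show N 3 1 0 = N 1 0 4 from cyc 3 1 0, unitR]; rfl
  have g32 : N 3 2 0 = 0 := by rw [show N 3 2 0 = N 2 0 4 from cyc 3 2 0, unitR]; rfl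
  have g33 : N 3 3 0 = 0 := by rw [show N 3 3 0 = N 3 0 4 from cyc 3 3 0, unitR]; rfl
  have g34 : N 3 4 0 = 1 := by rw [show N 3 4 0 = N 4 0 4 from cyc 3 4 0, unitR]; rfl
  have g41 : N 4 1 0 = 0 := by rw [show N 4 1 0 = N 1 0 3 from cyc 4 1 0, unitR]; rfl
  have g42 : N 4 2 0 = 0 := by rw [show N 4 2 0 = N 2 0 3 from cyc 4 2 0, unitR]; rfl
  have g43 : N 4 3 0 = 1 := by rw [show N 4 3 0 = N 3 0 3 from cyc 4 3 0, unitR]; rfl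
  have g44 : N 4 4 0 = 0 := by rw [show N 4 4 0 = N 4 0 3 from cyc 4 4 0, unitR]; rfl
  have A1113 := assoc 1 1 1 4
  have A1131 := assoc 1 1 3 2
  have A1311 := assoc 1 3 1 2
  have A3111 := assoc 3 1 1 2
  have A1114 := assoc 1 1 1 3
  have A1141 := assoc 1 1 4 2
  have A1411 := assoc 1 4 1 2
  have A4111 := assoc 4 1 1 2
  have A1133 := assoc 1 1 3 4
  have A1313 := assoc 1 3 1 4
  have A1331 := assoc 1 3 3 2
  have A3113 := assoc 3 1 1 4
  have A3131 := assoc 3 1 3 2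
  have A3311 := assoc 3 3 1 2
  have A1144 := assoc 1 1 4 3
  have A1414 := assoc 1 4 1 3
  have A1441 := assoc 1 4 4 2
  have A4114 := assoc 4 1 1 3
  have A4141 := assoc 4 1 4 2
  have A4411 := assoc 4 4 1 2
  have A1134 := assoc 1 1 3 3
  have A1143 := assoc 1 1 4 4
  have A1314 := assoc 1 3 1 3
  have A1341 := assoc 1 3 4 2
  have A1413 := assoc 1 4 1 4
  have A1431 := assoc 1 4 3 2
  have A3114 := assoc 3 1 1 3
  have A3141 := assoc 3 1 4 2
  have A3411 := assoc 3 4 1 2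
  have A4113 := assoc 4 1 1 4
  have A4131 := assoc 4 1 3 2
  have A4311 := assoc 4 3 1 2
  have A1123 := assoc 1 1 2 4
  have A1132 := assoc 1 1 3 1
  have A1213 := assoc 1 2 1 4
  have A1231 := assoc 1 2 3 2
  have A1312 := assoc 1 3 1 1
  have A1321 := assoc 1 3 2 2
  have A2113 := assoc 2 1 1 4
  have A2131 := assoc 2 1 3 2
  have A2311 := assoc 2 3 1 2
  have A3112 := assoc 3 1 1 1
  have A3121 := assoc 3 1 2 2
  have A3211 := assoc 3 2 1 2
  have A1124 := assoc 1 1 2 3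
  have A1142 := assoc 1 1 4 1
  have A1214 := assoc 1 2 1 3
  have A1241 := assoc 1 2 4 2
  have A1412 := assoc 1 4 1 1
  have A1421 := assoc 1 4 2 2
  have A2114 := assoc 2 1 1 3
  have A2141 := assoc 2 1 4 2
  have A2411 := assoc 2 4 1 2
  have A4112 := assoc 4 1 1 1
  have A4121 := assoc 4 1 2 2
  have A4211 := assoc 4 2 1 2
  have A1334 := assoc 1 3 3 3
  have A1343 := assoc 1 3 4 4
  have A1433 := assoc 1 4 3 4
  have A3134 := assoc 3 1 3 3
  have A3143 := assoc 3 1 4 4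
  have A3314 := assoc 3 3 1 3
  have A3341 := assoc 3 3 4 2
  have A3413 := assoc 3 4 1 4
  have A3431 := assoc 3 4 3 2
  have A4133 := assoc 4 1 3 4
  have A4313 := assoc 4 3 1 4
  have A4331 := assoc 4 3 3 2
  have A1344 := assoc 1 3 4 3
  have A1434 := assoc 1 4 3 3
  have A1443 := assoc 1 4 4 4
  have A3144 := assoc 3 1 4 3
  have A3414 := assoc 3 4 1 3
  have A3441 := assoc 3 4 4 2
  have A4134 := assoc 4 1 3 3
  have A4143 := assoc 4 1 4 4
  have A4314 := assoc 4 3 1 3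
  have A4341 := assoc 4 3 4 2
  have A4413 := assoc 4 4 1 4
  have A4431 := assoc 4 4 3 2
  have A1333 := assoc 1 3 3 4
  have A3133 := assoc 3 1 3 4
  have A3313 := assoc 3 3 1 4
  have A3331 := assoc 3 3 3 2
  have A3344 := assoc 3 3 4 3
  have A3434 := assoc 3 4 3 3
  have A3443 := assoc 3 4 4 4
  have A4334 := assoc 4 3 3 3
  have A4343 := assoc 4 3 4 4
  have A4433 := assoc 4 4 3 4
  have A1122 := assoc 1 1 2 1
  have A1212 := assoc 1 2 1 1
  have A1221 := assoc 1 2 2 2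
  have A2112 := assoc 2 1 1 1
  have A2121 := assoc 2 1 2 2
  have A2211 := assoc 2 2 1 2
  have A1234 := assoc 1 2 3 3
  have A1243 := assoc 1 2 4 4
  have A1324 := assoc 1 3 2 3
  have A1342 := assoc 1 3 4 1
  have A1423 := assoc 1 4 2 4
  have A1432 := assoc 1 4 3 1
  have A2134 := assoc 2 1 3 3
  have A2143 := assoc 2 1 4 4
  have A2314 := assoc 2 3 1 3
  have A2341 := assoc 2 3 4 2
  have A2413 := assoc 2 4 1 4
  have A2431 := assoc 2 4 3 2
  have A3124 := assoc 3 1 2 3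
  have A3142 := assoc 3 1 4 1
  have A3214 := assoc 3 2 1 3
  have A3241 := assoc 3 2 4 2
  have A3412 := assoc 3 4 1 1
  have A3421 := assoc 3 4 2 2
  have A4123 := assoc 4 1 2 4
  have A4132 := assoc 4 1 3 1
  have A4213 := assoc 4 2 1 4
  have A4231 := assoc 4 2 3 2
  have A4312 := assoc 4 3 1 1
  have A4321 := assoc 4 3 2 2
  have A1233 := assoc 1 2 3 4
  have A1323 := assoc 1 3 2 4
  have A1332 := assoc 1 3 3 1
  have A2133 := assoc 2 1 3 4
  have A2313 := assoc 2 3 1 4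
  have A2331 := assoc 2 3 3 2
  have A3123 := assoc 3 1 2 4
  have A3132 := assoc 3 1 3 1
  have A3213 := assoc 3 2 1 4
  have A3231 := assoc 3 2 3 2
  have A3312 := assoc 3 3 1 1
  have A3321 := assoc 3 3 2 2
  have A1223 := assoc 1 2 2 4
  have A1232 := assoc 1 2 3 1
  have A1322 := assoc 1 3 2 1
  have A2123 := assoc 2 1 2 4
  have A2132 := assoc 2 1 3 1
  have A2213 := assoc 2 2 1 4
  have A2231 := assoc 2 2 3 2
  have A2312 := assoc 2 3 1 1
  have A2321 := assoc 2 3 2 2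
  have A3122 := assoc 3 1 2 1
  have A3212 := assoc 3 2 1 1
  have A3221 := assoc 3 2 2 2
  simp only [Fin.sum_univ_five, unitL, unitR, Fin.reduceEq, reduceIte, Fin.isValue, e111, e112, e113, e114, e121, e122, e123, e124, e131, e132, e133, e134, e141, e142, e143, e144, e211, e212, e213, e214, e221, e222, e223, e224, e231, e232, e233, e234, e241, e242, e243, e244, e311, e312, e313, e314, e321, e322, e323, e324, e331, e332, e333, e334, e341, e342, e343, e344, e411, e412, e413, e414, e421, e422, e423, e424, e431, e432, e433, e434, e441, e442, e443, e444, g11, g12, g13, g14, g21, g22, g23, g24, g31, g32, g33, g34, g41, g42, g43, g44] at A1113 A1131 A1311 A3111 A1114 A1141 A1411 A4111 A1133 A1313 A1331 A3113 A3131 A3311 A1144 A1414 A1441 A4114 A4141 A4411 A1134 A1143 A1314 A1341 A1413 A1431 A3114 A3141 A3411 A4113 A4131 A4311 A1123 A1132 A1213 A1231 A1312 A1321 A2113 A2131 A2311 A3112 A3121 A3211 A1124 A1142 A1214 A1241 A1412 A1421 A2114 A2141 A2411 A4112 A4121 A4211 A1334 A1343 A1433 A3134 A3143 A3314 A3341 A3413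 A3431 A4133 A4313 A4331 A1344 A1434 A1443 A3144 A3414 A3441 A4134 A4143 A4314 A4341 A4413 A4431 A1333 A3133 A3313 A3331 A3344 A3434 A3443 A4334 A4343 A4433 A1122 A1212 A1221 A2112 A2121 A2211 A1234 A1243 A1324 A1342 A1423 A1432 A2134 A2143 A2314 A2341 A2413 A2431 A3124 A3142 A3214 A3241 A3412 A3421 A4123 A4132 A4213 A4231 A4312 A4321 A1233 A1323 A1332 A2133 A2313 A2331 A3123 A3132 A3213 A3231 A3312 A3321 A1223 A1232 A1322 A2123 A2132 A2213 A2231 A2312 A2321 A3122 A3212 A3221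
  have i113 : v2*s113=v4*s111 := by
    linarith only [A1113, A1131, A1311, A3111]
  have i114 : v2*s114=v3*s111 := by
    linarith only [A1114, A1141, A1411, A4111]
  have i133 : v2*s133=v4*s113 := by
    linarith only [A1133, A1313, A1331, A3113, A3131, A3311]
  have i144 : v2*s144=v3*s114 := by
    linarith only [A1144, A1414, A1441, A4114, A4141, A4411]
  have i112 : v2*s112=2*v2*s134-2*v4*s114+v1*s111 := by
    linarith only [A1134, A1143, A1314, A1341, A1413, A1431, A3114, A3141, A3411, A4113, A4131, A4311]
  have i123 : v2*s123=v3*s133-v4*s134+v4*s112 := by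
    linarith only [A1123, A1132, A1213, A1231, A1312, A1321, A2113, A2131, A2311, A3112, A3121, A3211]
  have i124 : v2*s124=v4*s144-v3*s134+v3*s112 := by
    linarith only [A1124, A1142, A1214, A1241, A1412, A1421, A2114, A2141, A2411, A4112, A4121, A4211]
  have i334 : v2*s334=2*v4*s134-v3*s133 := by
    linarith only [A1334, A1343, A1433, A3134, A3143, A3314, A3341, A3413, A3431, A4133, A4313, A4331]
  have i344 : v2*s344=2*v3*s134-v4*s144 := by
    linarith only [A1344, A1434, A1443, A3144, A3414, A3441, A4134, A4143, A4314, A4341, A4413, A4431]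
  have i333 : v2*s333=v4*s133 := by
    linarith only [A1333, A3133, A3313, A3331]
  have i234 : v2*s234=v1*s134 := by
    linarith only [A3344, A3434, A3443, A4334, A4343, A4433]
  have q34 : v3*s123=v4*s124 := by
    linarith only [A1122, A1212, A1221, A2112, A2121, A2211]
  have i122 : v2*(s234-s122)=v1*(s134-s112) := by
    linarith only [A1234, A1243, A1324, A1342, A1423, A1432, A2134, A2143, A2314, A2341, A2413, A2431, A3124, A3142, A3214, A3241, A3412, A3421, A4123, A4132, A4213, A4231, A4312, A4321]
  have i233 : 2*v2*s233=2*v4*s123+v3*s333-v4*s334 := by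
    linarith only [A1233, A1323, A1332, A2133, A2313, A2331, A3123, A3132, A3213, A3231, A3312, A3321]
  have i223 : v2*s223=2*(v3*s233-v4*s234)+v4*s122 := by
    linarith only [A1223, A1232, A1322, A2123, A2132, A2213, A2231, A2312, A2321, A3122, A3212, A3221]
  have E1 : s123*s124+s223*s114+s233*s144+s234*s134=1+(v1*v2+v3*v4)/4+s112*s234+s122*s134+s123*s344+s124*s334 := by
    linarith only [A1234, A1243, A1324, A1342, A1423, A1432, A2134, A2143, A2314, A2341, A2413, A2431, A3124, A3142, A3214, A3241, A3412, A3421, A4123, A4132, A4213, A4231, A4312, A4321]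
  have E2 : s111*s234+s112*s134+s113*s344+s114*s334-(s113*s124+s123*s114+s133*s144+s134*s134)=v2^2/4 := by
    linarith only [A1134, A1143, A1314, A1341, A1413, A1431, A3114, A3141, A3411, A4113, A4131, A4311]
  clear A1113 A1131 A1311 A3111 A1114 A1141 A1411 A4111 A1133 A1313 A1331 A3113 A3131 A3311 A1144 A1414 A1441 A4114 A4141 A4411 A1134 A1143 A1314 A1341 A1413 A1431 A3114 A3141 A3411 A4113 A4131 A4311 A1123 A1132 A1213 A1231 A1312 A1321 A2113 A2131 A2311 A3112 A3121 A3211 A1124 A1142 A1214 A1241 A1412 A1421 A2114 A2141 A2411 A4112 A4121 A4211 A1334 A1343 A1433 A3134 A3143 A3314 A3341 A3413 A3431 A4133 A4313 A4331 A1344 A1434 A1443 A3144 A3414 A3441 A4134 A4143 A4314 A4341 A4413 A4431 A1333 A3133 A3313 A3331 A3344 A3434 A3443 A4334 A4343 A4433 A1122 A1212 A1221 A2112 A2121 A2211 A1234 A1243 A1324 A1342 A1423 A1432 A2134 A2143 A2314 A2341 A2413 A2431 A3124 A3142 A3214 A3241 A3412 A3421 A4123 A4132 A4213 A4231 A4312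 A4321 A1233 A1323 A1332 A2133 A2313 A2331 A3123 A3132 A3213 A3231 A3312 A3321 A1223 A1232 A1322 A2123 A2132 A2213 A2231 A2312 A2321 A3122 A3212 A3221
  have p1 : 0 ≤ s123 - v4 / 2 := e123 ▸ hN 1 2 4
  have p2 : 0 ≤ s123 + v4 / 2 := e213 ▸ hN 2 1 4
  have p3 : 0 ≤ s124 + v3 / 2 := e124 ▸ hN 1 2 3
  have p4 : 0 ≤ s124 - v3 / 2 := e214 ▸ hN 2 1 3
  have p5 : 0 ≤ s134 - v2 / 2 := e134 ▸ hN 1 3 3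
  have p6 : 0 ≤ s134 + v2 / 2 := e314 ▸ hN 3 1 3
  have p7 : 0 ≤ s234 + v1 / 2 := e234 ▸ hN 2 3 3
  have p8 : 0 ≤ s234 - v1 / 2 := e324 ▸ hN 3 2 3
  rw [e134, e314]
  by_contra hne
  have hv : v2 ≠ 0 := by
    intro h
    apply hne
    rw [h]; ring
  have hP : 0 ≤ v1 * v2 := fusion_sign v1 v2 s134 s234 p5 p6 p8 p7 (by linarith only [i234])
  have hQ : 0 ≤ v3 * v4 := fusion_sign v3 v4 s123 s124 p1 p2 p4 p3 (by linarith only [q34])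
  exact fusion_alg v1 v2 v3 v4 s111 s112 s113 s114 s122 s123 s124 s133 s134 s144 s223 s233 s234
    s333 s334 s344 hv hP hQ i113 i114 i133 i144 i112 i123 i124 i334 i344 i333 i234 i122 i233
    i223 E1 E2

theorem dualIdx_dualIdx (k : Fin 5) : dualIdx (dualIdx k) = k := by
  revert k; decide

/-- A cyclic tensor which is symmetric on one ordering of each triple is symmetric. -/
theorem cyc_sym (T : Fin 5 → Fin 5 → Fin 5 → ℝ) (key : ∀ i j k, T i j k = T j k i)
    (c1 : T 1 3 4 = T 3 1 4) (c2 : T 2 3 4 = T 3 2 4) (c3 : T 3 1 2 = T 1 3 2)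
    (c4 : T 4 1 2 = T 1 4 2) (i j k : Fin 5) (hi : i ≠ 0) (hj : j ≠ 0) (hk : k ≠ 0)
    (hij : i ≠ j) (hik : i ≠ k) (hjk : j ≠ k) : T i j k = T j i k := by
  have k1 := key 1 3 4
  have k2 := key 3 4 1
  have k3 := key 3 1 4
  have k4 := key 1 4 3
  have l1 := key 2 3 4
  have l2 := key 3 4 2
  have l3 := key 3 2 4
  have l4 := key 2 4 3
  have m1 := key 3 1 2
  have m2 := key 1 2 3
  have m3 := key 1 3 2
  have m4 := key 3 2 1
  have n1 := key 4 1 2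
  have n2 := key 1 2 4
  have n3 := key 1 4 2
  have n4 := key 4 2 1
  clear key
  fin_cases i <;> fin_cases j <;> fin_cases k <;>
    first
      | exact absurd rfl hi
      | exact absurd rfl hj
      | exact absurd rfl hk
      | exact absurd rfl hij
      | exact absurd rfl hik
      | exact absurd rfl hjk
      | (clear hi hj hk hij hik hjk
         simp only [Fin.mk_one, Fin.reduceFinMk]
         linarith)

/-- Normalized fusion data (all dimensions equal to one). -/
structure NormFusion (N : Fin 5 → Fin 5 → Fin 5 → ℝ) : Prop where
  nonneg : ∀ i j k, 0 ≤ N i j k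
  unitL : ∀ j s, N 0 j s = if j = s then 1 else 0
  unitR : ∀ j s, N j 0 s = if j = s then 1 else 0
  assoc : ∀ i j k l, ∑ s, N i j s * N s k l = ∑ s, N i s l * N j k s
  cyc : ∀ i j k, N i j k = N j (dualIdx k) (dualIdx i)

theorem NormFusion.core {N : Fin 5 → Fin 5 → Fin 5 → ℝ} (h : NormFusion N) : N 1 3 3 = N 3 1 3 :=
  fusion_core N h.nonneg h.unitL h.unitR h.assoc h.cyc

theorem NormFusion.permuted {N : Fin 5 → Fin 5 → Fin 5 → ℝ} (h : NormFusion N)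
    (σ : Equiv.Perm (Fin 5)) (h0 : σ 0 = 0) (hσ : ∀ i, σ (dualIdx i) = dualIdx (σ i)) :
    NormFusion (fun i j k => N (σ i) (σ j) (σ k)) where
  nonneg _ _ _ := h.nonneg _ _ _
  unitL j s := by simp [h0, h.unitL]
  unitR j s := by simp [h0, h.unitR]
  assoc i j k l := by
    rw [Equiv.sum_comp σ (fun s => N (σ i) (σ j) s * N s (σ k) (σ l)),
      Equiv.sum_comp σ (fun s => N (σ i) s (σ l) * N (σ j) (σ k) s)]
    exact h.assoc _ _ _ _
  cyc i j k := by
    simp only [hσ]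
    exact h.cyc _ _ _

theorem NormFusion.comm {N : Fin 5 → Fin 5 → Fin 5 → ℝ} (h : NormFusion N) (i j k : Fin 5) :
    N i j k = N j i k := by
  have c1 := h.core
  have c2 : N 2 3 3 = N 3 2 3 :=
    (h.permuted (Equiv.swap 1 2) (by decide) (by decide)).core
  have c3 : N 3 1 1 = N 1 3 1 :=
    (h.permuted (Equiv.swap 1 3 * Equiv.swap 2 4) (by decide) (by decide)).core
  have c4 : N 4 1 1 = N 1 4 1 :=
    (h.permuted (Equiv.swap 3 4 * (Equiv.swap 1 3 * Equiv.swap 2 4)) (by decide) (by decide)).core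
  have cyc := h.cyc
  have key : ∀ i j k : Fin 5, N i j (dualIdx k) = N j k (dualIdx i) := by
    intro i j k
    have := h.cyc i j (dualIdx k)
    rwa [dualIdx_dualIdx] at this
  by_cases hi : i = 0
  · rw [hi, h.unitL, h.unitR]
  by_cases hj : j = 0
  · rw [hj, h.unitL, h.unitR]
  obtain ⟨k, rfl⟩ : ∃ l, k = dualIdx l := ⟨dualIdx k, (dualIdx_dualIdx k).symm⟩
  by_cases hk : k = 0
  · rw [hk, key i j 0, key j i 0, h.unitR, h.unitR]
    have hiff : j = dualIdx i ↔ i = dualIdx j :=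
      ⟨fun e => by rw [e, dualIdx_dualIdx], fun e => by rw [e, dualIdx_dualIdx]⟩
    simp only [hiff]
  by_cases hij : i = j
  · rw [hij]
  by_cases hik : i = k
  · rw [hik, key k j k, key j k k, key k k j]
  by_cases hjk : j = k
  · rw [hjk, key k i k, key i k k, key k k i]
  exact cyc_sym (fun i j k => N i j (dualIdx k)) key c1 c2 c3 c4 i j k hi hj hk hij hik hjk

theorem stmt12 (N : Fin 5 → Fin 5 → Fin 5 → ℝ) (d : Fin 5 → ℝ)
    (bar : Fin 5 → Fin 5) (hbar : bar = ![0, 2, 1, 4, 3])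
    (hN : ∀ i j k, 0 ≤ N i j k) (hd : ∀ i, 0 < d i)
    (hdbar : ∀ i, d i = d (bar i))
    (unitL : ∀ j s, N 0 j s = if j = s then 1 else 0)
    (unitR : ∀ j s, N j 0 s = if j = s then 1 else 0)
    (assoc : ∀ i j k l, ∑ s, N i j s * N s k l = ∑ s, N i s l * N j k s)
    (hfrob : ∀ i j k, N i j k * d k = N j (bar k) (bar i) * d (bar i)) :
    N 1 2 3 = N 2 1 3 ∧ ∀ i j k, N i j k = N j i k := by
  suffices H : ∀ i j k, N i j k = N j i k from ⟨H _ _ _, H⟩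
  have hb : bar = dualIdx := hbar
  subst hb
  obtain ⟨e, he, hed⟩ : ∃ e : Fin 5 → ℝ, (∀ i, 0 < e i) ∧ ∀ i, e i ^ 2 = d i / d 0 :=
    ⟨fun i => Real.sqrt (d i / d 0), fun i => Real.sqrt_pos.2 (div_pos (hd i) (hd 0)),
      fun i => Real.sq_sqrt (div_pos (hd i) (hd 0)).le⟩
  have hne : ∀ i, e i ≠ 0 := fun i => (he i).ne'
  have e0 : e 0 = 1 := by
    have h := hed 0
    rw [div_self (hd 0).ne'] at h
    nlinarith [he 0]
  have eb : ∀ i, e (dualIdx i) = e i := by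
    intro i
    have h : e (dualIdx i) ^ 2 = e i ^ 2 := by rw [hed, hed, ← hdbar i]
    exact (pow_left_inj₀ (he _).le (he _).le two_ne_zero).1 h
  have hM : NormFusion (fun i j k => N i j k * e k / (e i * e j)) := by
    refine ⟨?_, ?_, ?_, ?_, ?_⟩
    · intro i j k
      have := hN i j k
      have := he i
      have := he j
      have := he k
      positivity
    · intro j s
      simp only [unitL, e0]
      split_ifs with h
      · subst h; field_simp [hne]
      · simp
    · intro j s
      simp only [unitR, e0]
      split_ifs with h
      · subst h; field_simp [hne]
      · simp
    · intro i j k l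
      have h := congrArg (fun x => x * (e l / (e i * e j * e k))) (assoc i j k l)
      simp only [Finset.sum_mul] at h
      refine Eq.trans (Eq.trans ?_ h) ?_
      · refine Finset.sum_congr rfl fun s _ => ?_
        have := hne s
        have := hne i
        have := hne j
        have := hne k
        field_simp
      · refine Finset.sum_congr rfl fun s _ => ?_
        have := hne s
        have := hne i
        have := hne j
        have := hne k
        field_simp
    · intro i j k
      simp only [eb]
      have h := hfrob i j k
      rw [← hdbar i] at h
      have h2 : N i j k * e k ^ 2 = N j (dualIdx k) (dualIdx i) * e i ^ 2 := by
        rw [hed, hed, ← mul_div_assoc, ← mul_div_assoc, h]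
      have := hne i
      have := hne j
      have := hne k
      field_simp
      linear_combination h2
  intro i j k
  have h := hM.comm i j k
  beta_reduce at h
  rw [mul_comm (e j) (e i)] at h
  have h1 := hne i
  have h2 := hne j
  have h3 := hne k
  field_simp at h
  exact h
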